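/- For every $d\ge 1$ and every $I=(I_1,\dots,I_d)\in\mathcal{I}_d$ one has, in $A$, $\omega_I=d_{I_1}\,\omega_{(I_2,\dots,I_d)}-\tfrac12\sum_{k=2}^d(-1)^{k}\,\varepsilon_{I_1,I_k}\,\partial_{t_{I_1,I_k}}\,\omega_{(I_2,\dots,\widehat{I_k},\dots,I_d)}$, where $(I_2,\dots,\widehat{I_k},\dots,I_d)\in\mathcal{I}_{d-2}$ is the tuple obtained from $I$ by deleting the first and the $k$-th entries. -/

import Mathlib

open scoped Classical

noncomputable section
/-- The complementary index `t_{ijkl}`: the unique element of `Fin 5` not among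
distinct `i,j,k,l` (garbage value otherwise, where `eps` vanishes anyway). -/
def tIdx (i j k l : Fin 5) : Fin 5 :=
  ⟨(10 - (i.val + j.val + k.val + l.val)) % 5, Nat.mod_lt _ (by norm_num)⟩

/-- The sign `ε_{ijkl}`: the sign of the permutation `(i,j,k,l,t_{ijkl})` of `Fin 5`
if `i,j,k,l` are pairwise distinct, and `0` otherwise (Levi-Civita formula). -/
def eps (i j k l : Fin 5) : ℤ :=
  ∏ q : Fin 5, ∏ p ∈ Finset.univ.filter (fun p => p < q),
    Int.sign ((![(i.val : ℤ), (j.val : ℤ), (k.val : ℤ), (l.val : ℤ), ((tIdx i j k l).val : ℤ)]) q -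
      (![(i.val : ℤ), (j.val : ℤ), (k.val : ℤ), (l.val : ℤ), ((tIdx i j k l).val : ℤ)]) p)

/-- A unital associative `ℂ`-algebra `A` together with elements `d i j` and `∂ t`
satisfying the defining relations of `U_- = U(g_{-1} ⊕ g_{-2})` for `E(5,10)`. -/
structure E510Rep (A : Type*) [Ring A] [Algebra ℂ A] where
  d : Fin 5 → Fin 5 → A
  p : Fin 5 → A
  d_antisymm : ∀ i j, d i j = - d j i
  pd_comm : ∀ t i j, p t * d i j = d i j * p t
  pp_comm : ∀ s t, p s * p t = p t * p s
  dd_rel : ∀ i j k l, d i j * d k l + d k l * d i j = eps i j k l • p (tIdx i j k l)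

/-- Self-intersection free families of position pairs (each pair recorded as an
ordered pair `(k,l)` with `k < l`; the pairs are pairwise disjoint). -/
def isSIF {n : ℕ} (S : Finset (Fin n × Fin n)) : Prop :=
  (∀ q ∈ S, q.1 < q.2) ∧
    ∀ q ∈ S, ∀ q' ∈ S, q ≠ q' → q.1 ≠ q'.1 ∧ q.1 ≠ q'.2 ∧ q.2 ≠ q'.1 ∧ q.2 ≠ q'.2

/-- Two disjoint pairs cross if exactly one member of one lies strictly between
the members of the other. -/
def crosses {n : ℕ} (q q' : Fin n × Fin n) : Prop :=
  (q.1 < q'.1 ∧ q'.1 < q.2 ∧ q.2 < q'.2) ∨ (q'.1 < q.1 ∧ q.1 < q'.2 ∧ q'.2 < q.2)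

/-- The crossing number `c(S)`: the number of (unordered) pairs of elements of `S`
that cross (each counted once, using the order of first components). -/
def crossNum {n : ℕ} (S : Finset (Fin n × Fin n)) : ℕ :=
  ((S ×ˢ S).filter (fun z => z.1.1 < z.2.1 ∧ crosses z.1 z.2)).card

/-- The scalar part of `D_S(I)`: the product over `{k,l} ∈ S` of `(1/2)(-1)^{k+l} ε_{I_k,I_l}`. -/
def DScalar {n : ℕ} (I : Fin n → Fin 5 × Fin 5) (S : Finset (Fin n × Fin n)) : ℂ :=
  ∏ q ∈ S, ((-1 : ℂ) ^ (q.1.val + q.2.val) *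
    ((eps (I q.1).1 (I q.1).2 (I q.2).1 (I q.2).2 : ℤ) : ℂ) / 2)

/-- The multiplicity of `∂ t` in `D_S(I)`. -/
def pCount {n : ℕ} (I : Fin n → Fin 5 × Fin 5) (S : Finset (Fin n × Fin n)) (t : Fin 5) : ℕ :=
  (S.filter (fun q => tIdx (I q.1).1 (I q.1).2 (I q.2).1 (I q.2).2 = t)).card

section Alg

variable {A : Type*} [Ring A] [Algebra ℂ A]

/-- The monomial `∂^M = ∂_1^{m_1} ⋯ ∂_5^{m_5}`. -/
def pMono (pp : Fin 5 → A) (c : Fin 5 → ℕ) : A :=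
  pp 0 ^ c 0 * pp 1 ^ c 1 * pp 2 ^ c 2 * pp 3 ^ c 3 * pp 4 ^ c 4

/-- `d_{C_S(I)}`: the ordered product of the `d`'s over the positions of `I`
not covered by `S`. -/
def dRest (dd : Fin 5 → Fin 5 → A) {n : ℕ} (I : Fin n → Fin 5 × Fin 5)
    (S : Finset (Fin n × Fin n)) : A :=
  (((Finset.univ.filter (fun i : Fin n => ∀ q ∈ S, i ≠ q.1 ∧ i ≠ q.2)).sort (· ≤ ·)).map
    (fun i => dd (I i).1 (I i).2)).prod

/-- The summand `(-1)^{c(S)} D_S(I) d_{C_S(I)}` of `ω_I` (here `D_S(I)` is written as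
its scalar part times the corresponding `∂`-monomial, to which it is equal since
the `∂`'s commute). -/
def omegaBody (dd : Fin 5 → Fin 5 → A) (pp : Fin 5 → A) {n : ℕ}
    (I : Fin n → Fin 5 × Fin 5) (S : Finset (Fin n × Fin n)) : A :=
  ((-1 : ℂ) ^ crossNum S * DScalar I S) • (pMono pp (pCount I S) * dRest dd I S)

/-- `ω_I = ∑_{S SIF} (-1)^{c(S)} D_S(I) d_{C_S(I)}`. -/
def omegaOf (dd : Fin 5 → Fin 5 → A) (pp : Fin 5 → A) {n : ℕ} (I : Fin n → Fin 5 × Fin 5) : A :=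
  ∑ S : Finset (Fin n × Fin n), if isSIF S then omegaBody dd pp I S else 0

end Alg
section OmegaExpansion

variable {n m : ℕ}

/-- The family of pairs obtained by relabelling positions along an order embedding. -/
def mapPairs (f : Fin n ↪o Fin m) (S : Finset (Fin n × Fin n)) : Finset (Fin m × Fin m) :=
  S.map (f.toEmbedding.prodMap f.toEmbedding)

theorem mem_mapPairs {f : Fin n ↪o Fin m} {S : Finset (Fin n × Fin n)} {q : Fin m × Fin m} :
    q ∈ mapPairs f S ↔ ∃ a b, (a, b) ∈ S ∧ (f a, f b) = q := by
  simp [mapPairs]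

theorem forall_mem_mapPairs {f : Fin n ↪o Fin m} {S : Finset (Fin n × Fin n)}
    {P : Fin m × Fin m → Prop} :
    (∀ q ∈ mapPairs f S, P q) ↔ ∀ q ∈ S, P (f q.1, f q.2) :=
  Finset.forall_mem_map

theorem sum_mapPairs {M : Type*} [AddCommMonoid M] (f : Fin n ↪o Fin m)
    (S : Finset (Fin n × Fin n)) (F : Fin m × Fin m → M) :
    ∑ q ∈ mapPairs f S, F q = ∑ q ∈ S, F (f q.1, f q.2) :=
  Finset.sum_map _ _ _

theorem prod_mapPairs {M : Type*} [CommMonoid M] (f : Fin n ↪o Fin m)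
    (S : Finset (Fin n × Fin n)) (F : Fin m × Fin m → M) :
    ∏ q ∈ mapPairs f S, F q = ∏ q ∈ S, F (f q.1, f q.2) :=
  Finset.prod_map _ _ _

theorem mapPairs_injective (f : Fin n ↪o Fin m) : Function.Injective (mapPairs f) :=
  Finset.map_injective _

theorem exists_mapPairs_eq (f : Fin n ↪o Fin m) (T : Finset (Fin m × Fin m))
    (h : ∀ q ∈ T, q.1 ∈ Set.range f ∧ q.2 ∈ Set.range f) : ∃ S, mapPairs f S = T := by
  refine ⟨Finset.univ.filter (fun q => (f q.1, f q.2) ∈ T), ?_⟩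
  ext q
  rw [mem_mapPairs]
  constructor
  · rintro ⟨a, b, hab, rfl⟩
    simpa using hab
  · intro hq
    obtain ⟨⟨a, ha⟩, ⟨b, hb⟩⟩ := h q hq
    exact ⟨a, b, by simpa [ha, hb] using hq, by simp [ha, hb]⟩

theorem isSIF_mapPairs (f : Fin n ↪o Fin m) (S : Finset (Fin n × Fin n)) :
    isSIF (mapPairs f S) ↔ isSIF S := by
  simp [isSIF, forall_mem_mapPairs, Prod.ext_iff, -Prod.forall]

theorem crossNum_eq_sum (S : Finset (Fin n × Fin n)) :
    crossNum S = ∑ a ∈ S, ∑ b ∈ S, if a.1 < b.1 ∧ crosses a b then 1 else 0 := by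
  rw [crossNum, Finset.card_filter, Finset.sum_product]

theorem crossNum_mapPairs (f : Fin n ↪o Fin m) (S : Finset (Fin n × Fin n)) :
    crossNum (mapPairs f S) = crossNum S := by
  simp only [crossNum_eq_sum, sum_mapPairs]
  refine Finset.sum_congr rfl fun a _ => Finset.sum_congr rfl fun b _ => if_congr ?_ rfl rfl
  simp only [crosses, OrderEmbedding.lt_iff_lt]

theorem pCount_mapPairs (f : Fin n ↪o Fin m) (I : Fin m → Fin 5 × Fin 5)
    (S : Finset (Fin n × Fin n)) : pCount I (mapPairs f S) = pCount (I ∘ f) S := by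
  funext t
  simp only [pCount, Finset.card_filter, sum_mapPairs, Function.comp_apply]

theorem sort_map_orderEmbedding (f : Fin n ↪o Fin m) (s : Finset (Fin n)) :
    (s.map f.toEmbedding).sort (· ≤ ·) = (s.sort (· ≤ ·)).map f := by
  refine List.Perm.eq_of_pairwise' (r := (· ≤ ·)) (Finset.pairwise_sort _ _) ?_ ?_
  · rw [List.pairwise_map]
    exact (Finset.pairwise_sort s (· ≤ ·)).imp (fun h => f.monotone h)
  · rw [List.perm_ext_iff_of_nodup (Finset.sort_nodup _ _)
      ((Finset.sort_nodup _ _).map f.injective)]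
    simp

/-- The positions not covered by a family of pairs. -/
def uncovered (S : Finset (Fin n × Fin n)) : Finset (Fin n) :=
  Finset.univ.filter (fun i => ∀ q ∈ S, i ≠ q.1 ∧ i ≠ q.2)

theorem dRest_eq {A : Type*} [Ring A] [Algebra ℂ A] (d : Fin 5 → Fin 5 → A)
    (I : Fin n → Fin 5 × Fin 5) (S : Finset (Fin n × Fin n)) :
    dRest d I S = (((uncovered S).sort (· ≤ ·)).map (fun i => d (I i).1 (I i).2)).prod :=
  rfl

theorem uncovered_mapPairs_succ (S : Finset (Fin n × Fin n)) :
    uncovered (mapPairs (Fin.succOrderEmb n) S) =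
      insert 0 ((uncovered S).map (Fin.succOrderEmb n).toEmbedding) := by
  ext i
  refine Fin.cases ?_ (fun i => ?_) i
  · simp [uncovered, forall_mem_mapPairs, (Fin.succ_ne_zero _).symm, -Prod.forall]
  · simp [uncovered, forall_mem_mapPairs, -Prod.forall]

theorem dRest_mapPairs_succ {A : Type*} [Ring A] [Algebra ℂ A] (d : Fin 5 → Fin 5 → A)
    (I : Fin (n + 1) → Fin 5 × Fin 5) (S : Finset (Fin n × Fin n)) :
    dRest d I (mapPairs (Fin.succOrderEmb n) S) =
      d (I 0).1 (I 0).2 * dRest d (fun a => I a.succ) S := by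
  rw [dRest_eq, uncovered_mapPairs_succ, Finset.sort_insert _ (by simp) (by simp),
    sort_map_orderEmbedding, dRest_eq]
  simp [Function.comp_def]

/-- The order embedding skipping the positions `0` and `k + 1`. -/
def skipEmb (k : Fin (n + 1)) : Fin n ↪o Fin (n + 2) :=
  (Fin.succAboveOrderEmb k).trans (Fin.succOrderEmb (n + 1))

theorem skipEmb_apply (k : Fin (n + 1)) (a : Fin n) : skipEmb k a = (k.succAbove a).succ :=
  rfl

theorem mem_range_skipEmb (k : Fin (n + 1)) (i : Fin (n + 2)) :
    i ∈ Set.range (skipEmb k) ↔ i ≠ 0 ∧ i ≠ k.succ := by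
  simp only [Set.mem_range, skipEmb_apply]
  refine Fin.cases ?_ (fun i => ?_) i
  · simp [Fin.succ_ne_zero]
  · simp [← Fin.exists_succAbove_eq_iff, Fin.succ_ne_zero]

theorem val_skipEmb (k : Fin (n + 1)) (a : Fin n) :
    (skipEmb k a).val = if a.val < k.val then a.val + 1 else a.val + 2 := by
  simp only [skipEmb_apply, Fin.succAbove, Fin.lt_def, Fin.val_castSucc, Fin.val_succ]
  split_ifs <;> simp

/-- The family obtained from `S` by inserting the pair `(0, k + 1)` of new positions. -/
def consPair (k : Fin (n + 1)) (S : Finset (Fin n × Fin n)) :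
    Finset (Fin (n + 2) × Fin (n + 2)) :=
  insert (0, k.succ) (mapPairs (skipEmb k) S)

theorem zero_pair_notMem_mapPairs (k : Fin (n + 1)) (j : Fin (n + 2))
    (S : Finset (Fin n × Fin n)) :
    (0, j) ∉ mapPairs (skipEmb k) S := by
  rw [mem_mapPairs]
  rintro ⟨a, b, -, h⟩
  exact Fin.succ_ne_zero _ (congrArg Prod.fst h)

theorem uncovered_consPair (k : Fin (n + 1)) (S : Finset (Fin n × Fin n)) :
    uncovered (consPair k S) = (uncovered S).map (skipEmb k).toEmbedding := by
  ext i
  by_cases hi : i ∈ Set.range (skipEmb k)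
  · have h := (mem_range_skipEmb k i).1 hi
    obtain ⟨a, rfl⟩ := hi
    simp [uncovered, consPair, forall_mem_mapPairs, h.1, h.2,
      -Prod.forall]
  · have h : i ∉ (uncovered S).map (skipEmb k).toEmbedding := by
      simp only [Finset.mem_map, not_exists, not_and]
      exact fun a _ ha => hi ⟨a, ha⟩
    refine iff_of_false (fun hc => hi ((mem_range_skipEmb k i).2 ?_)) h
    exact (Finset.mem_filter.1 hc).2 _ (Finset.mem_insert_self _ _)

theorem dRest_consPair {A : Type*} [Ring A] [Algebra ℂ A] (d : Fin 5 → Fin 5 → A)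
    (I : Fin (n + 2) → Fin 5 × Fin 5) (k : Fin (n + 1)) (S : Finset (Fin n × Fin n)) :
    dRest d I (consPair k S) = dRest d (I ∘ skipEmb k) S := by
  rw [dRest_eq, uncovered_consPair, sort_map_orderEmbedding, dRest_eq, List.map_map]
  rfl

theorem isSIF_consPair (k : Fin (n + 1)) (S : Finset (Fin n × Fin n)) :
    isSIF (consPair k S) ↔ isSIF S := by
  rw [← isSIF_mapPairs (skipEmb k) S]
  have hr : ∀ q ∈ mapPairs (skipEmb k) S,
      (q.1 ≠ 0 ∧ q.1 ≠ k.succ) ∧ q.2 ≠ 0 ∧ q.2 ≠ k.succ := by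
    intro q hq
    obtain ⟨a, b, -, rfl⟩ := mem_mapPairs.1 hq
    exact ⟨(mem_range_skipEmb k _).1 ⟨a, rfl⟩, (mem_range_skipEmb k _).1 ⟨b, rfl⟩⟩
  constructor
  · rintro ⟨h1, h2⟩
    exact ⟨fun q hq => h1 q (Finset.mem_insert_of_mem hq), fun q hq q' hq' =>
      h2 q (Finset.mem_insert_of_mem hq) q' (Finset.mem_insert_of_mem hq')⟩
  · rintro ⟨h1, h2⟩
    refine ⟨fun q hq => ?_, fun q hq q' hq' hne => ?_⟩
    · rcases Finset.mem_insert.1 hq with rfl | hq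
      · exact Fin.succ_pos k
      · exact h1 q hq
    · rcases Finset.mem_insert.1 hq with rfl | hq <;>
        rcases Finset.mem_insert.1 hq' with rfl | hq'
      · exact absurd rfl hne
      · obtain ⟨⟨h3, h4⟩, h5, h6⟩ := hr q' hq'
        exact ⟨h3.symm, h5.symm, h4.symm, h6.symm⟩
      · obtain ⟨⟨h3, h4⟩, h5, h6⟩ := hr q hq
        exact ⟨h3, h4, h5, h6⟩
      · exact h2 q hq q' hq' hne

theorem crossNum_consPair (k : Fin (n + 1)) (S : Finset (Fin n × Fin n)) :
    crossNum (consPair k S) = crossNum S +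
      (S.filter (fun q => skipEmb k q.1 < k.succ ∧ k.succ < skipEmb k q.2)).card := by
  have hpos : ∀ a, 0 < skipEmb k a := fun a => Fin.succ_pos _
  have hnew : ∀ q : Fin n × Fin n,
      ((0 : Fin (n + 2)) < skipEmb k q.1 ∧
        crosses (0, k.succ) (skipEmb k q.1, skipEmb k q.2)) ↔
      skipEmb k q.1 < k.succ ∧ k.succ < skipEmb k q.2 := fun q => by
    simp only [crosses, hpos, true_and, (hpos q.1).not_gt, false_and, or_false]
  rw [← crossNum_mapPairs (skipEmb k) S, crossNum_eq_sum, crossNum_eq_sum, consPair,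
    Finset.sum_insert (zero_pair_notMem_mapPairs _ _ _), add_comm,
    Finset.sum_insert (zero_pair_notMem_mapPairs _ _ _)]
  congr 1
  · refine Finset.sum_congr rfl fun q _ => ?_
    rw [Finset.sum_insert (zero_pair_notMem_mapPairs _ _ _),
      if_neg (fun h => Fin.not_lt_zero _ h.1), zero_add]
  · rw [if_neg (fun h => lt_irrefl _ h.1), zero_add, sum_mapPairs, Finset.card_filter]
    exact Finset.sum_congr rfl fun q _ => if_congr (hnew q) rfl rfl

theorem neg_one_pow_skipEmb (k : Fin (n + 1)) {a b : Fin n} (hab : a < b) :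
    (if skipEmb k a < k.succ ∧ k.succ < skipEmb k b then (-1 : ℂ) else 1) *
      (-1) ^ ((skipEmb k a).val + (skipEmb k b).val) = (-1) ^ (a.val + b.val) := by
  simp only [Fin.lt_def, val_skipEmb, Fin.val_succ] at hab ⊢
  by_cases h1 : a.val < k.val <;> by_cases h2 : b.val < k.val
  · rw [if_neg (by simp [h1, h2]; omega)]; simp [h1, h2]; ring
  · rw [if_pos (by simp [h1, h2]; omega)]; simp [h1, h2]; ring
  · omega
  · rw [if_neg (by simp [h1, h2]; omega)]; simp [h1, h2]; ring

theorem sign_mul_DScalar_consPair (I : Fin (n + 2) → Fin 5 × Fin 5) (k : Fin (n + 1))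
    {S : Finset (Fin n × Fin n)} (hS : isSIF S) :
    (-1 : ℂ) ^ crossNum (consPair k S) * DScalar I (consPair k S) =
      -((1 / 2) * ((-1) ^ (k : ℕ) *
        ((eps (I 0).1 (I 0).2 (I k.succ).1 (I k.succ).2 : ℤ) : ℂ))) *
        ((-1) ^ crossNum S * DScalar (I ∘ skipEmb k) S) := by
  have key : (-1 : ℂ) ^ (S.filter
        (fun q => skipEmb k q.1 < k.succ ∧ k.succ < skipEmb k q.2)).card *
      DScalar I (mapPairs (skipEmb k) S) = DScalar (I ∘ skipEmb k) S := by
    rw [← Finset.prod_const, Finset.prod_filter, DScalar, prod_mapPairs, DScalar,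
      ← Finset.prod_mul_distrib]
    refine Finset.prod_congr rfl fun q hq => ?_
    rw [← neg_one_pow_skipEmb k (hS.1 q hq)]
    simp only [Function.comp_apply]
    ring
  rw [← key, crossNum_consPair, DScalar, consPair,
    Finset.prod_insert (zero_pair_notMem_mapPairs _ _ _), ← DScalar]
  simp only [Fin.val_zero, Fin.val_succ]
  ring

theorem DScalar_mapPairs_succ (I : Fin (n + 1) → Fin 5 × Fin 5) (S : Finset (Fin n × Fin n)) :
    DScalar I (mapPairs (Fin.succOrderEmb n) S) = DScalar (fun a => I a.succ) S := by
  rw [DScalar, prod_mapPairs, DScalar]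
  refine Finset.prod_congr rfl fun q _ => ?_
  simp only [Fin.coe_succOrderEmb, Fin.val_succ]
  ring

theorem pCount_consPair (I : Fin (n + 2) → Fin 5 × Fin 5) (k : Fin (n + 1))
    (S : Finset (Fin n × Fin n)) :
    pCount I (consPair k S) = pCount (I ∘ skipEmb k) S +
      Pi.single (tIdx (I 0).1 (I 0).2 (I k.succ).1 (I k.succ).2) 1 := by
  funext t
  rw [← pCount_mapPairs, consPair, pCount, Finset.filter_insert, Pi.add_apply, Pi.single_apply]
  split_ifs with h1 h2 h2
  · rw [Finset.card_insert_of_notMem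
      (fun h => zero_pair_notMem_mapPairs _ _ _ (Finset.mem_of_mem_filter _ h))]
    rfl
  · exact absurd h1.symm h2
  · exact absurd h2.symm h1
  · rfl

theorem pMono_add_single {A : Type*} [Ring A] [Algebra ℂ A] (p : Fin 5 → A)
    (hp : ∀ s t, p s * p t = p t * p s) (c : Fin 5 → ℕ) (t : Fin 5) :
    pMono p (c + Pi.single t 1) = p t * pMono p c := by
  have hc : ∀ s, p s ^ (c s) * p t = p t * p s ^ (c s) :=
    fun s => (Commute.pow_left (hp s t) (c s)).eq
  have hc' : ∀ s x, p s ^ (c s) * (p t * x) = p t * (p s ^ (c s) * x) := fun s x => by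
    rw [← mul_assoc, hc, mul_assoc]
  fin_cases t <;> simp [pMono, pow_succ', mul_assoc] at hc hc' ⊢ <;>
    simp [hc']

theorem commute_pMono {A : Type*} [Ring A] [Algebra ℂ A] {p : Fin 5 → A} {x : A}
    (hx : ∀ t, Commute x (p t)) (c : Fin 5 → ℕ) : Commute x (pMono p c) := by
  unfold pMono
  exact (((((hx 0).pow_right _).mul_right ((hx 1).pow_right _)).mul_right
    ((hx 2).pow_right _)).mul_right ((hx 3).pow_right _)).mul_right ((hx 4).pow_right _)

theorem omegaBody_mapPairs_succ {A : Type*} [Ring A] [Algebra ℂ A] (R : E510Rep A)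
    (I : Fin (n + 1) → Fin 5 × Fin 5) (S : Finset (Fin n × Fin n)) :
    omegaBody R.d R.p I (mapPairs (Fin.succOrderEmb n) S) =
      R.d (I 0).1 (I 0).2 * omegaBody R.d R.p (fun a => I a.succ) S := by
  have h : Commute (R.d (I 0).1 (I 0).2) (pMono R.p (pCount (fun a => I a.succ) S)) :=
    commute_pMono (fun t => (R.pd_comm t _ _).symm) _
  rw [omegaBody, crossNum_mapPairs, DScalar_mapPairs_succ, pCount_mapPairs, dRest_mapPairs_succ,
    omegaBody, mul_smul_comm, ← mul_assoc, ← mul_assoc, h.eq]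
  rfl

theorem omegaBody_consPair {A : Type*} [Ring A] [Algebra ℂ A] (R : E510Rep A)
    (I : Fin (n + 2) → Fin 5 × Fin 5) (k : Fin (n + 1))
    {S : Finset (Fin n × Fin n)} (hS : isSIF S) :
    omegaBody R.d R.p I (consPair k S) =
      -((1 / 2 : ℂ) • (((-1 : ℂ) ^ (k : ℕ) *
        ((eps (I 0).1 (I 0).2 (I k.succ).1 (I k.succ).2 : ℤ) : ℂ)) •
        (R.p (tIdx (I 0).1 (I 0).2 (I k.succ).1 (I k.succ).2) *
          omegaBody R.d R.p (I ∘ skipEmb k) S))) := by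
  rw [omegaBody, sign_mul_DScalar_consPair I k hS, pCount_consPair,
    pMono_add_single _ R.pp_comm, dRest_consPair, omegaBody, mul_smul_comm, smul_smul, smul_smul,
    ← neg_smul, mul_assoc]
  congr 1
  ring

theorem omegaOf_eq_sum_filter {A : Type*} [Ring A] [Algebra ℂ A] (d : Fin 5 → Fin 5 → A)
    (p : Fin 5 → A) (I : Fin n → Fin 5 × Fin 5) :
    omegaOf d p I = ∑ S ∈ Finset.univ.filter isSIF, omegaBody d p I S := by
  rw [omegaOf, Finset.sum_filter]

theorem isSIF.snd_ne_zero {S : Finset (Fin (n + 1) × Fin (n + 1))} (hS : isSIF S)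
    {q : Fin (n + 1) × Fin (n + 1)} (hq : q ∈ S) : q.2 ≠ 0 :=
  Fin.ne_zero_of_lt (hS.1 q hq)

theorem sum_isSIF_of_forall_fst_ne_zero {M : Type*} [AddCommMonoid M]
    (F : Finset (Fin (n + 1) × Fin (n + 1)) → M) :
    ∑ S ∈ (Finset.univ.filter isSIF).filter (fun S => ∀ q ∈ S, q.1 ≠ 0), F S =
      ∑ S ∈ Finset.univ.filter isSIF, F (mapPairs (Fin.succOrderEmb n) S) := by
  symm
  refine Finset.sum_bij (fun S _ => mapPairs (Fin.succOrderEmb n) S) ?_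
    (fun S _ T _ h => mapPairs_injective _ h) ?_ (fun _ _ => rfl)
  · intro S hS
    simp only [Finset.mem_filter, Finset.mem_univ, true_and] at hS ⊢
    refine ⟨(isSIF_mapPairs _ _).2 hS, fun q hq => ?_⟩
    obtain ⟨a, b, -, rfl⟩ := mem_mapPairs.1 hq
    exact Fin.succ_ne_zero a
  · intro T hT
    simp only [Finset.mem_filter, Finset.mem_univ, true_and] at hT
    obtain ⟨S, rfl⟩ := exists_mapPairs_eq (Fin.succOrderEmb n) T fun q hq =>
      ⟨Fin.exists_succ_eq.2 (hT.2 q hq), Fin.exists_succ_eq.2 (hT.1.snd_ne_zero hq)⟩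
    exact ⟨S, by simpa using (isSIF_mapPairs _ _).1 hT.1, rfl⟩

theorem consPair_injective2 : Function.Injective2 (consPair (n := n)) := by
  intro k l S T h
  have hk : (0, k.succ) ∈ consPair l T := h ▸ Finset.mem_insert_self _ _
  obtain rfl : k = l := by
    rcases Finset.mem_insert.1 hk with hk | hk
    · simpa using hk
    · exact absurd hk (zero_pair_notMem_mapPairs _ _ _)
  refine ⟨rfl, mapPairs_injective (skipEmb k) ?_⟩
  rw [← Finset.erase_insert (zero_pair_notMem_mapPairs k k.succ S),
    ← Finset.erase_insert (zero_pair_notMem_mapPairs k k.succ T)]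
  exact congrArg (fun U => Finset.erase U (0, k.succ)) h

theorem sum_isSIF_of_exists_fst_eq_zero {M : Type*} [AddCommMonoid M]
    (F : Finset (Fin (n + 2) × Fin (n + 2)) → M) :
    ∑ S ∈ (Finset.univ.filter isSIF).filter (fun S => ¬ ∀ q ∈ S, q.1 ≠ 0), F S =
      ∑ k : Fin (n + 1), ∑ S ∈ Finset.univ.filter isSIF, F (consPair k S) := by
  rw [← Finset.sum_product']
  symm
  refine Finset.sum_bij (fun x _ => consPair x.1 x.2) ?_ ?_ ?_ (fun _ _ => rfl)
  · rintro ⟨k, S⟩ hS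
    simp only [Finset.mem_product, Finset.mem_filter, Finset.mem_univ, true_and] at hS ⊢
    exact ⟨(isSIF_consPair k S).2 hS, fun h => h _ (Finset.mem_insert_self _ _) rfl⟩
  · rintro ⟨k, S⟩ - ⟨l, T⟩ - h
    obtain ⟨rfl, rfl⟩ := consPair_injective2 h
    rfl
  · intro T hT
    simp only [Finset.mem_filter, Finset.mem_univ, true_and, not_forall, not_not] at hT
    obtain ⟨hT, ⟨i, j⟩, hq, rfl : i = 0⟩ := hT
    obtain ⟨k, rfl⟩ := Fin.exists_succ_eq.2 (hT.snd_ne_zero hq)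
    obtain ⟨S, hS⟩ := exists_mapPairs_eq (skipEmb k) (T.erase (0, k.succ)) fun q hq' => by
      obtain ⟨hne, hqT⟩ := Finset.mem_erase.1 hq'
      obtain ⟨h1, h2, h3, h4⟩ := hT.2 q hqT _ hq hne
      exact ⟨(mem_range_skipEmb k _).2 ⟨h1, h2⟩, (mem_range_skipEmb k _).2 ⟨h3, h4⟩⟩
    have hc : consPair k S = T := by rw [consPair, hS, Finset.insert_erase hq]
    exact ⟨(k, S), by simpa using (isSIF_consPair k S).1 (hc ▸ hT), hc⟩

end OmegaExpansion

/-- Equation (recursive formula for `ω`):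
`ω_I = d_{I_1} ω_{(I_2,…,I_d)} - (1/2) ∑_{k=2}^d (-1)^k ε_{I_1,I_k} ∂_{t_{I_1,I_k}} ω_{(I_2,…,Î_k,…,I_d)}`. -/
theorem omega_cons_expansion {A : Type*} [Ring A] [Algebra ℂ A] (R : E510Rep A)
    (m : ℕ) (I : Fin (m + 1) → Fin 5 × Fin 5) :
    omegaOf R.d R.p I
      = R.d (I 0).1 (I 0).2 * omegaOf R.d R.p (fun a : Fin m => I a.succ)
        - ((1 : ℂ) / 2) •
            ∑ k : Fin m,
              ((-1 : ℂ) ^ (k : ℕ) *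
                  ((eps (I 0).1 (I 0).2 (I k.succ).1 (I k.succ).2 : ℤ) : ℂ)) •
                (R.p (tIdx (I 0).1 (I 0).2 (I k.succ).1 (I k.succ).2) *
                  omegaOf R.d R.p
                    (fun a : Fin (m - 1) =>
                      I (Fin.succ
                        ⟨if (a : ℕ) < (k : ℕ) then (a : ℕ) else (a : ℕ) + 1,
                          by have := a.isLt; split <;> omega⟩))) := by
  rw [omegaOf_eq_sum_filter R.d R.p I,
    ← Finset.sum_filter_add_sum_filter_not _ (fun S => ∀ q ∈ S, q.1 ≠ 0),
    sum_isSIF_of_forall_fst_ne_zero, sub_eq_add_neg, omegaOf_eq_sum_filter, Finset.mul_sum]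
  congr 1
  · exact Finset.sum_congr rfl fun S _ => omegaBody_mapPairs_succ R I S
  · cases m with
    | zero =>
      simp only [Finset.univ_eq_empty (α := Fin 0), Finset.sum_empty, smul_zero, neg_zero]
      refine Finset.sum_eq_zero fun S hS => absurd (fun q hq h => ?_) (Finset.mem_filter.1 hS).2
      have hS' := (Finset.mem_filter.1 (Finset.mem_filter.1 hS).1).2
      exact hS'.snd_ne_zero hq (Fin.fin_one_eq_zero _)
    | succ n =>
      rw [sum_isSIF_of_exists_fst_eq_zero, Finset.smul_sum, ← Finset.sum_neg_distrib]
      refine Finset.sum_congr rfl fun k _ => ?_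
      have hI : (fun a : Fin (n + 1 - 1) => I (Fin.succ
          ⟨if (a : ℕ) < (k : ℕ) then (a : ℕ) else (a : ℕ) + 1,
            by have := a.isLt; split <;> omega⟩)) = I ∘ skipEmb k := by
        funext a
        refine congrArg I (Fin.ext ?_)
        rw [val_skipEmb, Fin.val_succ]
        dsimp only
        split_ifs <;> rfl
      rw [hI, omegaOf_eq_sum_filter, Finset.mul_sum, Finset.smul_sum, Finset.smul_sum,
        ← Finset.sum_neg_distrib]
      exact Finset.sum_congr rfl fun S hS =>
        omegaBody_consPair R I k (Finset.mem_filter.1 hS).2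

end
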